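/- Let M be a popular feasible matching in a marriage instance with critical men, and let level be a level assignment such that: level(m) = level(w) for every (m,w) ∈ M; every vertex unmatched in M has level 0; every (+1,+1) edge (m,w) has level(w) > level(m); every edge (m,w) ∈ E with level(w) = level(m) − 1 is a (−1,−1) edge; and no edge (m,w) ∈ E has level(w) ≤ level(m) − 2. Then no vertex of G belongs both to a size-increasing alternating path for M and to a size-reducing alternating path for M with respect to level. -/

import Mathlib

open Classical

universe u v

/-- A marriage instance with critical men: a finite bipartite graph with edge set `E ⊆ A × B`,
a set `C ⊆ A` of critical men, and strict preference orders of each vertex over its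
neighbours (`prefA m w w'` : man `m` strictly prefers woman `w` to woman `w'`;
`prefB w m m'` : woman `w` strictly prefers man `m` to man `m'`). -/
structure CritInstance (A : Type u) (B : Type v) where
  E : Finset (A × B)
  C : Finset A
  prefA : A → B → B → Prop
  prefB : B → A → A → Prop
  prefA_irrefl : ∀ m w, ¬ prefA m w w
  prefA_trans : ∀ m w₁ w₂ w₃, prefA m w₁ w₂ → prefA m w₂ w₃ → prefA m w₁ w₃
  prefA_total : ∀ m w₁ w₂, (m, w₁) ∈ E → (m, w₂) ∈ E → w₁ ≠ w₂ →
    prefA m w₁ w₂ ∨ prefA m w₂ w₁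
  prefB_irrefl : ∀ w m, ¬ prefB w m m
  prefB_trans : ∀ w m₁ m₂ m₃, prefB w m₁ m₂ → prefB w m₂ m₃ → prefB w m₁ m₃
  prefB_total : ∀ w m₁ m₂, (m₁, w) ∈ E → (m₂, w) ∈ E → m₁ ≠ m₂ →
    prefB w m₁ m₂ ∨ prefB w m₂ m₁

namespace CritInstance

variable {A : Type u} {B : Type v}

/-- `M` is a matching: a set of edges in which every vertex has at most one partner. -/
def IsMatching (I : CritInstance A B) (M : Finset (A × B)) : Prop :=
  M ⊆ I.E ∧ (∀ ⦃m w w'⦄, (m, w) ∈ M → (m, w') ∈ M → w = w') ∧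
    (∀ ⦃m m' w⦄, (m, w) ∈ M → (m', w) ∈ M → m = m')

/-- Man `m` is matched in `M`. -/
def ManMatched (M : Finset (A × B)) (m : A) : Prop := ∃ w, (m, w) ∈ M

/-- Woman `w` is matched in `M`. -/
def WomanMatched (M : Finset (A × B)) (w : B) : Prop := ∃ m, (m, w) ∈ M

/-- `M` is feasible: it is a matching and every critical man is matched. -/
def IsFeasible (I : CritInstance A B) (M : Finset (A × B)) : Prop :=
  IsMatching I M ∧ ∀ m ∈ I.C, ManMatched M m

/-- Man `m` prefers matching `M` to matching `N`: he is matched in `M` and either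
unmatched in `N` or strictly prefers his `M`-partner to his `N`-partner. -/
def ManPrefers (I : CritInstance A B) (M N : Finset (A × B)) (m : A) : Prop :=
  ∃ w, (m, w) ∈ M ∧ (¬ ManMatched N m ∨ ∃ w', (m, w') ∈ N ∧ I.prefA m w w')

/-- Woman `w` prefers matching `M` to matching `N`. -/
def WomanPrefers (I : CritInstance A B) (M N : Finset (A × B)) (w : B) : Prop :=
  ∃ m, (m, w) ∈ M ∧ (¬ WomanMatched N w ∨ ∃ m', (m', w) ∈ N ∧ I.prefB w m m')

/-- `phi I M N` is the number of vertices that prefer `M` to `N`. -/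
noncomputable def phi [Fintype A] [Fintype B] (I : CritInstance A B)
    (M N : Finset (A × B)) : ℕ :=
  (Finset.univ.filter fun m : A => ManPrefers I M N m).card +
    (Finset.univ.filter fun w : B => WomanPrefers I M N w).card

/-- `M` is a popular feasible matching. -/
def IsPFM [Fintype A] [Fintype B] (I : CritInstance A B) (M : Finset (A × B)) : Prop :=
  IsFeasible I M ∧ ∀ N, IsFeasible I N → phi I N M ≤ phi I M N

/-- `M` is a minimum size popular feasible matching. -/
def IsMinPFM [Fintype A] [Fintype B] (I : CritInstance A B) (M : Finset (A × B)) : Prop :=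
  IsPFM I M ∧ ∀ N, IsPFM I N → M.card ≤ N.card

/-- `M` is a dominant feasible matching. -/
def IsDFM [Fintype A] [Fintype B] (I : CritInstance A B) (M : Finset (A × B)) : Prop :=
  IsPFM I M ∧ ∀ N, IsFeasible I N → M.card < N.card → phi I N M < phi I M N

/-- `(m,w)` is a `(+1,+1)` edge with respect to `M`: an edge of `E ∖ M` such that `m` is
unmatched or prefers `w` to his partner, and `w` is unmatched or prefers `m` to her partner. -/
def PlusPlus (I : CritInstance A B) (M : Finset (A × B)) (m : A) (w : B) : Prop :=
  (m, w) ∈ I.E ∧ (m, w) ∉ M ∧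
    (¬ ManMatched M m ∨ ∃ w', (m, w') ∈ M ∧ I.prefA m w w') ∧
    (¬ WomanMatched M w ∨ ∃ m', (m', w) ∈ M ∧ I.prefB w m m')

/-- `(m,w)` is a `(−1,−1)` edge with respect to `M`: an edge of `E ∖ M` such that `m` is
matched and prefers his partner to `w`, and `w` is matched and prefers her partner to `m`. -/
def MinusMinus (I : CritInstance A B) (M : Finset (A × B)) (m : A) (w : B) : Prop :=
  (m, w) ∈ I.E ∧ (m, w) ∉ M ∧
    (∃ w', (m, w') ∈ M ∧ I.prefA m w' w) ∧
    (∃ m', (m', w) ∈ M ∧ I.prefB w m' m)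

/-- `M` is a stable matching: a matching with no blocking pair. -/
def IsStable (I : CritInstance A B) (M : Finset (A × B)) : Prop :=
  IsMatching I M ∧ ∀ m w, ¬ PlusPlus I M m w

/-- The min-size conditions for a level assignment `(lA, lB)` with respect to `M`:
(i) matched partners share a level, unmatched vertices have level 0, non-critical men
have level 0; (ii) every `(+1,+1)` edge goes from a man to a strictly higher level woman;
(iii) every edge from a man at level `i` to a woman at level `i − 1` is a `(−1,−1)` edge;
(iv) no edge goes from a man at level `i` to a woman at level `≤ i − 2`. -/
def MinSizeConds (I : CritInstance A B) (M : Finset (A × B))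
    (lA : A → ℕ) (lB : B → ℕ) : Prop :=
  (∀ m w, (m, w) ∈ M → lA m = lB w) ∧
  (∀ m, ¬ ManMatched M m → lA m = 0) ∧
  (∀ w, ¬ WomanMatched M w → lB w = 0) ∧
  (∀ m, m ∉ I.C → lA m = 0) ∧
  (∀ m w, PlusPlus I M m w → lA m < lB w) ∧
  (∀ m w, (m, w) ∈ I.E → lB w + 1 = lA m → MinusMinus I M m w) ∧
  (∀ m w, (m, w) ∈ I.E → ¬ (lB w + 2 ≤ lA m))

/-- The dominant conditions for a level assignment `(lA, lB)` with respect to `M`: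
(i) matched partners share a level, unmatched women have level 0, unmatched men have
level 1, non-critical men have level at most 1; (ii)–(iv) as in the min-size conditions. -/
def DomConds (I : CritInstance A B) (M : Finset (A × B))
    (lA : A → ℕ) (lB : B → ℕ) : Prop :=
  (∀ m w, (m, w) ∈ M → lA m = lB w) ∧
  (∀ m, ¬ ManMatched M m → lA m = 1) ∧
  (∀ w, ¬ WomanMatched M w → lB w = 0) ∧
  (∀ m, m ∉ I.C → lA m ≤ 1) ∧
  (∀ m w, PlusPlus I M m w → lA m < lB w) ∧
  (∀ m w, (m, w) ∈ I.E → lB w + 1 = lA m → MinusMinus I M m w) ∧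
  (∀ m w, (m, w) ∈ I.E → ¬ (lB w + 2 ≤ lA m))

/-- Adjacency in the bipartite graph, on the vertex set `A ⊕ B`. -/
def Adj (I : CritInstance A B) : A ⊕ B → A ⊕ B → Prop
  | Sum.inl m, Sum.inr w => (m, w) ∈ I.E
  | Sum.inr w, Sum.inl m => (m, w) ∈ I.E
  | _, _ => False

/-- The (directed) pair `(u, v)` of vertices spans an edge of the matching `M`. -/
def StepM (M : Finset (A × B)) : A ⊕ B → A ⊕ B → Prop
  | Sum.inl m, Sum.inr w => (m, w) ∈ M
  | Sum.inr w, Sum.inl m => (m, w) ∈ M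
  | _, _ => False

/-- The pair `(u, v)` of vertices spans a `(+1,+1)` edge with respect to `M`. -/
def StepPP (I : CritInstance A B) (M : Finset (A × B)) : A ⊕ B → A ⊕ B → Prop
  | Sum.inl m, Sum.inr w => PlusPlus I M m w
  | Sum.inr w, Sum.inl m => PlusPlus I M m w
  | _, _ => False

/-- The pair `(u, v)` of vertices spans a `(−1,−1)` edge with respect to `M`. -/
def StepMM (I : CritInstance A B) (M : Finset (A × B)) : A ⊕ B → A ⊕ B → Prop
  | Sum.inl m, Sum.inr w => MinusMinus I M m w
  | Sum.inr w, Sum.inl m => MinusMinus I M m w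
  | _, _ => False

/-- A vertex of `A ⊕ B` is matched in `M`. -/
def VMatched (M : Finset (A × B)) : A ⊕ B → Prop
  | Sum.inl m => ManMatched M m
  | Sum.inr w => WomanMatched M w

/-- An `M`-alternating path in the graph: a sequence of distinct vertices
`vert 0, …, vert len` (`len ≥ 1` edges), consecutive vertices adjacent, with
consecutive edges alternately inside and outside `M`. -/
structure AltPath (I : CritInstance A B) (M : Finset (A × B)) where
  len : ℕ
  len_pos : 0 < len
  vert : ℕ → A ⊕ B
  inj : ∀ i j, i ≤ len → j ≤ len → vert i = vert j → i = j
  adj : ∀ i, i < len → Adj I (vert i) (vert (i + 1))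
  alternate : ∀ i, i + 1 < len →
    (StepM M (vert i) (vert (i + 1)) ↔ ¬ StepM M (vert (i + 1)) (vert (i + 2)))

namespace AltPath

variable {I : CritInstance A B} {M : Finset (A × B)}

/-- The number of `(+1,+1)` edges of the path. -/
noncomputable def countPP (ρ : AltPath I M) : ℕ :=
  ((Finset.range ρ.len).filter fun i => StepPP I M (ρ.vert i) (ρ.vert (i + 1))).card

/-- The number of `(−1,−1)` edges of the path. -/
noncomputable def countMM (ρ : AltPath I M) : ℕ :=
  ((Finset.range ρ.len).filter fun i => StepMM I M (ρ.vert i) (ρ.vert (i + 1))).card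

/-- The vertex `u` lies on the path. -/
def Mem (ρ : AltPath I M) (u : A ⊕ B) : Prop := ∃ i ≤ ρ.len, ρ.vert i = u

/-- The set of edges of the path, as a set of pairs in `A × B`. -/
noncomputable def edges (ρ : AltPath I M) : Finset (A × B) :=
  I.E.filter fun e => ∃ i < ρ.len,
    (ρ.vert i = Sum.inl e.1 ∧ ρ.vert (i + 1) = Sum.inr e.2) ∨
    (ρ.vert i = Sum.inr e.2 ∧ ρ.vert (i + 1) = Sum.inl e.1)

end AltPath

/-- An `M`-alternating cycle: a closed sequence of vertices `vert 0, …, vert len = vert 0`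
(distinct except for the return), consecutive vertices adjacent, with edges alternately
inside and outside `M`, including around the wrap. -/
structure AltCycle (I : CritInstance A B) (M : Finset (A × B)) where
  len : ℕ
  len_pos : 0 < len
  vert : ℕ → A ⊕ B
  closed : vert len = vert 0
  inj : ∀ i j, i < len → j < len → vert i = vert j → i = j
  adj : ∀ i, i < len → Adj I (vert i) (vert (i + 1))
  alternate : ∀ i, i + 1 < len →
    (StepM M (vert i) (vert (i + 1)) ↔ ¬ StepM M (vert (i + 1)) (vert (i + 2)))
  alternate_wrap : StepM M (vert (len - 1)) (vert len) ↔ ¬ StepM M (vert 0) (vert 1)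

namespace AltCycle

variable {I : CritInstance A B} {M : Finset (A × B)}

/-- The number of `(+1,+1)` edges of the cycle. -/
noncomputable def countPP (σ : AltCycle I M) : ℕ :=
  ((Finset.range σ.len).filter fun i => StepPP I M (σ.vert i) (σ.vert (i + 1))).card

/-- The number of `(−1,−1)` edges of the cycle. -/
noncomputable def countMM (σ : AltCycle I M) : ℕ :=
  ((Finset.range σ.len).filter fun i => StepMM I M (σ.vert i) (σ.vert (i + 1))).card

end AltCycle

/-- A size-increasing alternating path (SIAP) for `M`: an `M`-alternating path whose two
endpoints are a man unmatched in `M` and a woman unmatched in `M`, and which has equally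
many `(+1,+1)` and `(−1,−1)` edges. -/
def IsSIAP (I : CritInstance A B) (M : Finset (A × B)) (ρ : AltPath I M) : Prop :=
  (((∃ m, ρ.vert 0 = Sum.inl m ∧ ¬ ManMatched M m) ∧
      (∃ w, ρ.vert ρ.len = Sum.inr w ∧ ¬ WomanMatched M w)) ∨
    ((∃ w, ρ.vert 0 = Sum.inr w ∧ ¬ WomanMatched M w) ∧
      (∃ m, ρ.vert ρ.len = Sum.inl m ∧ ¬ ManMatched M m))) ∧
  ρ.countPP = ρ.countMM

/-- A size-reducing alternating path (SRAP) for `M` with respect to the level assignment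
`(lA, lB)`: an `M`-alternating path both of whose terminal edges lie in `M`, starting at a
woman matched in `M` at level 0, ending at a non-critical man at level 1, whose number of
`(+1,+1)` edges is exactly one more than its number of `(−1,−1)` edges. -/
def IsSRAP (I : CritInstance A B) (M : Finset (A × B)) (lA : A → ℕ) (lB : B → ℕ)
    (ρ : AltPath I M) : Prop :=
  StepM M (ρ.vert 0) (ρ.vert 1) ∧
  StepM M (ρ.vert (ρ.len - 1)) (ρ.vert ρ.len) ∧
  (((∃ w, ρ.vert 0 = Sum.inr w ∧ WomanMatched M w ∧ lB w = 0) ∧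
      (∃ m, ρ.vert ρ.len = Sum.inl m ∧ m ∉ I.C ∧ lA m = 1)) ∨
    ((∃ m, ρ.vert 0 = Sum.inl m ∧ m ∉ I.C ∧ lA m = 1) ∧
      (∃ w, ρ.vert ρ.len = Sum.inr w ∧ WomanMatched M w ∧ lB w = 0))) ∧
  ρ.countPP = ρ.countMM + 1

end CritInstance

namespace CritInstance

variable {A : Type u} {B : Type v} {I : CritInstance A B} {M : Finset (A × B)}

theorem Adj.symm {x y : A ⊕ B} (h : Adj I x y) : Adj I y x := by
  cases x <;> cases y <;> exact h

theorem stepM_comm (x y : A ⊕ B) : StepM M x y ↔ StepM M y x := by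
  cases x <;> cases y <;> simp [StepM]

theorem stepPP_comm (x y : A ⊕ B) : StepPP I M x y ↔ StepPP I M y x := by
  cases x <;> cases y <;> simp [StepPP]

theorem stepMM_comm (x y : A ⊕ B) : StepMM I M x y ↔ StepMM I M y x := by
  cases x <;> cases y <;> simp [StepMM]

namespace AltPath

/-- The same path traversed backwards. -/
def reverse (ρ : AltPath I M) : AltPath I M where
  len := ρ.len
  len_pos := ρ.len_pos
  vert i := ρ.vert (ρ.len - i)
  inj i j hi hj h := by
    have := ρ.inj _ _ (Nat.sub_le _ _) (Nat.sub_le _ _) h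
    omega
  adj i hi := by
    have := ρ.adj (ρ.len - (i + 1)) (by omega)
    rw [show ρ.len - (i + 1) + 1 = ρ.len - i by omega] at this
    exact this.symm
  alternate i hi := by
    have := ρ.alternate (ρ.len - (i + 2)) (by omega)
    rw [show ρ.len - (i + 2) + 1 = ρ.len - (i + 1) by omega,
      show ρ.len - (i + 2) + 2 = ρ.len - i by omega] at this
    rw [stepM_comm (ρ.vert (ρ.len - i)),
      stepM_comm (ρ.vert (ρ.len - (i + 1))) (ρ.vert (ρ.len - (i + 2)))]
    tauto

theorem card_filter_range_reflect (n : ℕ) (p : ℕ → Prop) :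
    ((Finset.range n).filter fun i => p (n - 1 - i)).card = ((Finset.range n).filter p).card := by
  simp only [Finset.card_filter]
  exact Finset.sum_range_reflect (fun i => if p i then 1 else 0) n

theorem countPP_reverse (ρ : AltPath I M) : ρ.reverse.countPP = ρ.countPP := by
  unfold countPP
  rw [← card_filter_range_reflect ρ.len]
  refine congrArg Finset.card (Finset.filter_congr fun i hi => ?_)
  have hi : i < ρ.len := Finset.mem_range.1 hi
  rw [stepPP_comm]
  simp only [reverse, show ρ.len - 1 - i = ρ.len - (i + 1) by omega,
    show ρ.len - (i + 1) + 1 = ρ.len - i by omega]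

theorem countMM_reverse (ρ : AltPath I M) : ρ.reverse.countMM = ρ.countMM := by
  unfold countMM
  rw [← card_filter_range_reflect ρ.len]
  refine congrArg Finset.card (Finset.filter_congr fun i hi => ?_)
  have hi : i < ρ.len := Finset.mem_range.1 hi
  rw [stepMM_comm]
  simp only [reverse, show ρ.len - 1 - i = ρ.len - (i + 1) by omega,
    show ρ.len - (i + 1) + 1 = ρ.len - i by omega]

theorem Mem.reverse {ρ : AltPath I M} {x : A ⊕ B} (h : ρ.Mem x) : ρ.reverse.Mem x := by
  obtain ⟨i, hi, rfl⟩ := h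
  exact ⟨ρ.len - i, Nat.sub_le _ _, by simp [AltPath.reverse, Nat.sub_sub_self hi]⟩

end AltPath

/-- The sum of the two labels of an edge, divided by two. -/
noncomputable def labelSum (I : CritInstance A B) (M : Finset (A × B)) (x y : A ⊕ B) : ℤ :=
  (if StepPP I M x y then 1 else 0) - (if StepMM I M x y then 1 else 0)

/-- The level of a vertex, as an integer. -/
def level (lA : A → ℕ) (lB : B → ℕ) : A ⊕ B → ℤ :=
  Sum.elim (fun m => (lA m : ℤ)) (fun w => (lB w : ℤ))

/-- A directed step: a non-matching edge from a man to a woman, or a matching edge from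
a woman to a man. -/
def DirStep (I : CritInstance A B) (M : Finset (A × B)) : A ⊕ B → A ⊕ B → Prop
  | Sum.inl m, Sum.inr w => (m, w) ∈ I.E ∧ (m, w) ∉ M
  | Sum.inr w, Sum.inl m => (m, w) ∈ M
  | _, _ => False

/-- A directed step along which the level changes by exactly the half label sum. -/
def TightStep (I : CritInstance A B) (M : Finset (A × B)) (lA : A → ℕ) (lB : B → ℕ)
    (x y : A ⊕ B) : Prop :=
  DirStep I M x y ∧ labelSum I M x y = level lA lB y - level lA lB x

/-- The level conditions relating a matching and a level assignment. -/
structure LevelConds (I : CritInstance A B) (M : Finset (A × B))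
    (lA : A → ℕ) (lB : B → ℕ) : Prop where
  matched : ∀ m w, (m, w) ∈ M → lA m = lB w
  plusPlus : ∀ m w, PlusPlus I M m w → lA m < lB w
  minusMinus : ∀ m w, (m, w) ∈ I.E → lB w + 1 = lA m → MinusMinus I M m w
  noSteep : ∀ m w, (m, w) ∈ I.E → ¬ (lB w + 2 ≤ lA m)

theorem LevelConds.labelSum_le {lA : A → ℕ} {lB : B → ℕ} (hl : LevelConds I M lA lB)
    {x y : A ⊕ B} (h : DirStep I M x y) :
    labelSum I M x y ≤ level lA lB y - level lA lB x := by
  rcases x with m | w <;> rcases y with m' | w' <;> simp only [DirStep] at h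
  · have hp := hl.plusPlus m w'
    have hm := hl.minusMinus m w' h.1
    have hs := hl.noSteep m w' h.1
    simp only [labelSum, StepPP, StepMM, level, Sum.elim_inl, Sum.elim_inr]
    by_cases a : PlusPlus I M m w'
    · have := hp a
      by_cases b : MinusMinus I M m w' <;> simp only [a, b, if_true, if_false] <;> omega
    · by_cases b : MinusMinus I M m w'
      · simp only [a, b, if_true, if_false]
        omega
      · have : ¬ (lB w' + 1 = lA m) := fun e => b (hm e)
        simp only [a, b, if_false]
        omega
  · have := hl.matched _ _ h
    simp [labelSum, StepPP, StepMM, level, PlusPlus, MinusMinus, h, this]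

namespace AltPath

theorem dirStep (ρ : AltPath I M) (h0 : DirStep I M (ρ.vert 0) (ρ.vert 1)) :
    ∀ i, i < ρ.len → DirStep I M (ρ.vert i) (ρ.vert (i + 1)) := by
  intro i
  induction i with
  | zero => exact fun _ => h0
  | succ i ih =>
    intro hi
    have h1 := ih (by omega)
    have h2 := ρ.alternate i hi
    have h3 := ρ.adj (i + 1) hi
    revert h1 h2 h3
    rcases ρ.vert i with a | a <;> rcases ρ.vert (i + 1) with b | b <;>
      rcases ρ.vert (i + 1 + 1) with c | c <;> simp +contextual [DirStep, StepM, Adj]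

theorem tightStep (ρ : AltPath I M) {lA : A → ℕ} {lB : B → ℕ} (hl : LevelConds I M lA lB)
    (h0 : DirStep I M (ρ.vert 0) (ρ.vert 1))
    (hc : (ρ.countPP : ℤ) - ρ.countMM = level lA lB (ρ.vert ρ.len) - level lA lB (ρ.vert 0)) :
    ∀ i, i < ρ.len → TightStep I M lA lB (ρ.vert i) (ρ.vert (i + 1)) := by
  have hd := ρ.dirStep h0
  have hs : ∑ i ∈ Finset.range ρ.len, labelSum I M (ρ.vert i) (ρ.vert (i + 1)) =
      ∑ i ∈ Finset.range ρ.len, (level lA lB (ρ.vert (i + 1)) - level lA lB (ρ.vert i)) := by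
    rw [Finset.sum_range_sub fun i => level lA lB (ρ.vert i), ← hc]
    simp [labelSum, countPP, countMM, Finset.sum_sub_distrib]
  have := (Finset.sum_eq_sum_iff_of_le fun i hi =>
    hl.labelSum_le (hd i (Finset.mem_range.1 hi))).1 hs
  exact fun i hi => ⟨hd i hi, this i (Finset.mem_range.2 hi)⟩

end AltPath

theorem reflTransGen_of_steps {α : Type*} {r : α → α → Prop} {f : ℕ → α} {n : ℕ}
    (h : ∀ i, i < n → r (f i) (f (i + 1))) {i j : ℕ} (hij : i ≤ j) (hj : j ≤ n) :
    Relation.ReflTransGen r (f i) (f j) := by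
  induction j, hij using Nat.le_induction with
  | base => exact .refl
  | succ j hij ih => exact (ih (by omega)).tail (h j (by omega))

theorem exists_steps_of_reflTransGen {α : Type*} {r : α → α → Prop} {a b : α}
    (h : Relation.ReflTransGen r a b) :
    ∃ n, ∃ f : ℕ → α, f 0 = a ∧ f n = b ∧ ∀ i, i < n → r (f i) (f (i + 1)) := by
  induction h with
  | refl => exact ⟨0, fun _ => a, rfl, rfl, by simp⟩
  | @tail b c _ hbc ih =>
    obtain ⟨n, f, h0, hn, hf⟩ := ih
    refine ⟨n + 1, fun i => if i ≤ n then f i else c, by simp [h0], by simp, fun i hi => ?_⟩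
    rcases Nat.lt_or_ge i n with h | h
    · simpa [h.le, Nat.succ_le_of_lt h] using hf i h
    · obtain rfl : i = n := by omega
      simpa [hn] using hbc

/-- A relation chain can be shortcut to one without repetitions. -/
theorem exists_injective_steps_of_reflTransGen {α : Type*} {r : α → α → Prop} {a b : α}
    (h : Relation.ReflTransGen r a b) :
    ∃ n, ∃ f : ℕ → α, f 0 = a ∧ f n = b ∧ (∀ i, i < n → r (f i) (f (i + 1))) ∧
      ∀ i j, i ≤ n → j ≤ n → f i = f j → i = j := by
  have hex := exists_steps_of_reflTransGen h
  obtain ⟨f, h0, hn, hf⟩ := Nat.find_spec hex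
  have hmin := fun m => Nat.find_min (m := m) hex
  generalize Nat.find hex = n at *
  have key : ∀ i j, i < j → j ≤ n → f i ≠ f j := by
    intro i j hij hj he
    refine hmin (n - (j - i)) (by omega)
      ⟨fun k => if k ≤ i then f k else f (k + (j - i)), by simp [h0], ?_, fun k hk => ?_⟩
    · by_cases hle : n - (j - i) ≤ i
      · obtain rfl : j = n := by omega
        have : j - (j - i) = i := by omega
        simp [this, he, hn]
      · simp [hle, show n - (j - i) + (j - i) = n by omega, hn]
    · rcases Nat.lt_trichotomy k i with hki | rfl | hki
      · simpa [hki.le, Nat.succ_le_of_lt hki] using hf k (by omega)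
      · have := hf j (by omega)
        rw [← he] at this
        simpa [show k + 1 + (j - k) = j + 1 by omega] using this
      · have := hf (k + (j - i)) (by omega)
        simpa [show ¬ k ≤ i by omega, show ¬ k + 1 ≤ i by omega,
          show k + 1 + (j - i) = k + (j - i) + 1 by omega] using this
  refine ⟨n, f, h0, hn, hf, fun i j hi hj he => ?_⟩
  rcases Nat.lt_trichotomy i j with h | h | h
  · exact (key i j h hj he).elim
  · exact h
  · exact (key j i h hi he.symm).elim

/-- The matching obtained by switching `M` along the first `n` steps of `f`. -/
noncomputable def switch (I : CritInstance A B) (M : Finset (A × B)) (f : ℕ → A ⊕ B)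
    (n : ℕ) : Finset (A × B) :=
  (M.filter fun e => ¬ ∃ i < n, f i = Sum.inr e.2 ∧ f (i + 1) = Sum.inl e.1) ∪
    I.E.filter fun e => ∃ i < n, f i = Sum.inl e.1 ∧ f (i + 1) = Sum.inr e.2

/-- The vote of a vertex between `N` and `M`: `1` in favour of `N`, `-1` in favour of `M`. -/
noncomputable def vote (I : CritInstance A B) (N M : Finset (A × B)) : A ⊕ B → ℤ
  | Sum.inl m => (if ManPrefers I N M m then 1 else 0) - (if ManPrefers I M N m then 1 else 0)
  | Sum.inr w =>
    (if WomanPrefers I N M w then 1 else 0) - (if WomanPrefers I M N w then 1 else 0)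

theorem sum_vote [Fintype A] [Fintype B] (I : CritInstance A B) (N M : Finset (A × B)) :
    ∑ x, vote I N M x = (phi I N M : ℤ) - phi I M N := by
  simp only [Fintype.sum_sum_type, vote, Finset.sum_sub_distrib, phi, Nat.cast_add,
    Finset.natCast_card_filter]
  ring

theorem neg_one_le_vote (I : CritInstance A B) (N M : Finset (A × B)) (x : A ⊕ B) :
    -1 ≤ vote I N M x := by
  rcases x with m | w <;> simp only [vote] <;> split_ifs <;> norm_num

theorem ManPrefers.asymm {N : Finset (A × B)} (hM : IsMatching I M) (hN : IsMatching I N) {m : A}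
    (h : ManPrefers I N M m) : ¬ ManPrefers I M N m := by
  rintro ⟨w, hw, h'⟩
  obtain ⟨x, hx, h | ⟨y, hy, h⟩⟩ := h
  · exact h ⟨w, hw⟩
  obtain h' | ⟨z, hz, h'⟩ := h'
  · exact h' ⟨x, hx⟩
  obtain rfl := hM.2.1 hw hy
  obtain rfl := hN.2.1 hx hz
  exact I.prefA_irrefl _ _ (I.prefA_trans _ _ _ _ h h')

theorem WomanPrefers.asymm {N : Finset (A × B)} (hM : IsMatching I M) (hN : IsMatching I N)
    {w : B} (h : WomanPrefers I N M w) : ¬ WomanPrefers I M N w := by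
  rintro ⟨m, hm, h'⟩
  obtain ⟨x, hx, h | ⟨y, hy, h⟩⟩ := h
  · exact h ⟨m, hm⟩
  obtain h' | ⟨z, hz, h'⟩ := h'
  · exact h' ⟨x, hx⟩
  obtain rfl := hM.2.2 hm hy
  obtain rfl := hN.2.2 hx hz
  exact I.prefB_irrefl _ _ (I.prefB_trans _ _ _ _ h h')

theorem vote_inl_eq_one {N : Finset (A × B)} (hM : IsMatching I M) (hN : IsMatching I N) {m : A}
    (h : ManPrefers I N M m) : vote I N M (Sum.inl m) = 1 := by
  simp [vote, h, h.asymm hM hN]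

theorem vote_inr_eq_one {N : Finset (A × B)} (hM : IsMatching I M) (hN : IsMatching I N) {w : B}
    (h : WomanPrefers I N M w) : vote I N M (Sum.inr w) = 1 := by
  simp [vote, h, h.asymm hM hN]

/-- The ends of an edge of `N` outside `M` cast votes summing to at least its label sum. -/
theorem two_mul_labelSum_le_vote {N : Finset (A × B)} (hM : IsMatching I M)
    (hN : IsMatching I N) {m : A} {w : B} (h : (m, w) ∈ N) (hn : (m, w) ∉ M) :
    2 * labelSum I M (Sum.inl m) (Sum.inr w) ≤
      vote I N M (Sum.inl m) + vote I N M (Sum.inr w) := by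
  have hE := hN.1 h
  have b1 := neg_one_le_vote I N M (Sum.inl m)
  have b2 := neg_one_le_vote I N M (Sum.inr w)
  by_cases hP : PlusPlus I M m w
  · have v1 := vote_inl_eq_one hM hN ⟨w, h, hP.2.2.1⟩
    have v2 := vote_inr_eq_one hM hN ⟨m, h, hP.2.2.2⟩
    simp only [labelSum, StepPP, StepMM]
    omega
  by_cases hQ : MinusMinus I M m w
  · simp only [labelSum, StepPP, StepMM, hP, hQ, if_true, if_false]
    omega
  have : ManPrefers I N M m ∨ WomanPrefers I N M w := by
    by_contra! hc
    refine hQ ⟨hE, hn, ?_, ?_⟩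
    · by_cases hm : ManMatched M m
      · obtain ⟨w', hw'⟩ := hm
        refine ⟨w', hw', ?_⟩
        rcases I.prefA_total m w w' hE (hM.1 hw') (by rintro rfl; exact hn hw') with hp | hp
        · exact (hc.1 ⟨w, h, .inr ⟨w', hw', hp⟩⟩).elim
        · exact hp
      · exact (hc.1 ⟨w, h, .inl hm⟩).elim
    · by_cases hm : WomanMatched M w
      · obtain ⟨m', hm'⟩ := hm
        refine ⟨m', hm', ?_⟩
        rcases I.prefB_total w m m' hE (hM.1 hm') (by rintro rfl; exact hn hm') with hp | hp
        · exact (hc.2 ⟨m, h, .inr ⟨m', hm', hp⟩⟩).elim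
        · exact hp
      · exact (hc.2 ⟨m, h, .inl hm⟩).elim
  simp only [labelSum, StepPP, StepMM, hP, hQ, if_false]
  rcases this with hv | hv
  · have := vote_inl_eq_one hM hN hv
    omega
  · have := vote_inr_eq_one hM hN hv
    omega

section Switch

variable {f : ℕ → A ⊕ B} {n : ℕ} {a b : A}

theorem mem_switch {m : A} {w : B} : (m, w) ∈ switch I M f n ↔
    ((m, w) ∈ M ∧ ¬ ∃ i < n, f i = Sum.inr w ∧ f (i + 1) = Sum.inl m) ∨
      ((m, w) ∈ I.E ∧ ∃ i < n, f i = Sum.inl m ∧ f (i + 1) = Sum.inr w) := by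
  simp [switch]

theorem DirStep.exists_of_inl {m : A} {y : A ⊕ B} (h : DirStep I M (Sum.inl m) y) :
    ∃ w, y = Sum.inr w ∧ (m, w) ∈ I.E ∧ (m, w) ∉ M := by
  rcases y with m' | w
  · exact h.elim
  · exact ⟨w, rfl, h⟩

theorem DirStep.exists_of_inr {w : B} {y : A ⊕ B} (h : DirStep I M (Sum.inr w) y) :
    ∃ m, y = Sum.inl m ∧ (m, w) ∈ M := by
  rcases y with m | w'
  · exact ⟨m, rfl, h⟩
  · exact h.elim

theorem DirStep.exists_of_to_inl {m : A} {x : A ⊕ B} (h : DirStep I M x (Sum.inl m)) :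
    ∃ w, x = Sum.inr w ∧ (m, w) ∈ M := by
  rcases x with m' | w
  · exact h.elim
  · exact ⟨w, rfl, h⟩

theorem isMatching_switch (hM : IsMatching I M) (h0 : f 0 = Sum.inl a) (hn : f n = Sum.inl b)
    (ha : ¬ ManMatched M a) (hf : ∀ i, i < n → DirStep I M (f i) (f (i + 1)))
    (hinj : ∀ i j, i ≤ n → j ≤ n → f i = f j → i = j) : IsMatching I (switch I M f n) := by
  have man : ∀ m w w', (m, w) ∈ M →
      (¬ ∃ i < n, f i = Sum.inr w ∧ f (i + 1) = Sum.inl m) →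
      (∃ i < n, f i = Sum.inl m ∧ f (i + 1) = Sum.inr w') → False := by
    rintro m w w' hw hk ⟨i, hi, hi1, -⟩
    cases i with
    | zero =>
      obtain rfl := Sum.inl.inj (h0.symm.trans hi1)
      exact ha ⟨w, hw⟩
    | succ i =>
      have hd := hf i (by omega)
      rw [hi1] at hd
      obtain ⟨w'', hx, hw''⟩ := hd.exists_of_to_inl
      obtain rfl := hM.2.1 hw hw''
      exact hk ⟨i, by omega, hx, hi1⟩
  have woman : ∀ m m' w, (m, w) ∈ M →
      (¬ ∃ i < n, f i = Sum.inr w ∧ f (i + 1) = Sum.inl m) →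
      (∃ i < n, f i = Sum.inl m' ∧ f (i + 1) = Sum.inr w) → False := by
    rintro m m' w hw hk ⟨i, hi, -, hi2⟩
    have hne : i + 1 ≠ n := by
      rintro rfl
      simp [hi2] at hn
    have hd := hf (i + 1) (by omega)
    rw [hi2] at hd
    obtain ⟨m'', hx, hm''⟩ := hd.exists_of_inr
    obtain rfl := hM.2.2 hw hm''
    exact hk ⟨i + 1, by omega, hi2, hx⟩
  refine ⟨?_, ?_, ?_⟩
  · rintro ⟨m, w⟩ h
    rcases mem_switch.1 h with h | h
    · exact hM.1 h.1
    · exact h.1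
  · intro m w w' h h'
    rcases mem_switch.1 h with h | h <;> rcases mem_switch.1 h' with h' | h'
    · exact hM.2.1 h.1 h'.1
    · exact (man _ _ _ h.1 h.2 h'.2).elim
    · exact (man _ _ _ h'.1 h'.2 h.2).elim
    · obtain ⟨-, i, hi, hi1, hi2⟩ := h
      obtain ⟨-, j, hj, hj1, hj2⟩ := h'
      obtain rfl := hinj i j hi.le hj.le (hi1.trans hj1.symm)
      exact Sum.inr.inj (hi2.symm.trans hj2)
  · intro m m' w h h'
    rcases mem_switch.1 h with h | h <;> rcases mem_switch.1 h' with h' | h'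
    · exact hM.2.2 h.1 h'.1
    · exact (woman _ _ _ h.1 h.2 h'.2).elim
    · exact (woman _ _ _ h'.1 h'.2 h.2).elim
    · obtain ⟨-, i, hi, hi1, hi2⟩ := h
      obtain ⟨-, j, hj, hj1, hj2⟩ := h'
      have := hinj (i + 1) (j + 1) hi hj (hi2.trans hj2.symm)
      obtain rfl : i = j := by omega
      exact Sum.inl.inj (hi1.symm.trans hj1)

theorem isFeasible_switch (hM : IsFeasible I M) (h0 : f 0 = Sum.inl a) (hn : f n = Sum.inl b)
    (ha : ¬ ManMatched M a) (hb : b ∉ I.C) (hf : ∀ i, i < n → DirStep I M (f i) (f (i + 1)))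
    (hinj : ∀ i j, i ≤ n → j ≤ n → f i = f j → i = j) : IsFeasible I (switch I M f n) := by
  refine ⟨isMatching_switch hM.1 h0 hn ha hf hinj, fun m hm => ?_⟩
  obtain ⟨w, hw⟩ := hM.2 m hm
  by_cases hk : ∃ i < n, f i = Sum.inr w ∧ f (i + 1) = Sum.inl m
  · obtain ⟨i, hi, -, hi2⟩ := hk
    have hne : i + 1 ≠ n := by
      rintro rfl
      obtain rfl := Sum.inl.inj (hi2.symm.trans hn)
      exact hb hm
    have hd := hf (i + 1) (by omega)
    rw [hi2] at hd
    obtain ⟨w', hx, hw', -⟩ := hd.exists_of_inl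
    exact ⟨w', mem_switch.2 (.inr ⟨hw', i + 1, by omega, hi2, hx⟩)⟩
  · exact ⟨w, mem_switch.2 (.inl ⟨hw, hk⟩)⟩

theorem vote_switch_eq_zero {x : A ⊕ B} (hx : ∀ i ≤ n, f i ≠ x) :
    vote I (switch I M f n) M x = 0 := by
  rcases x with m | w
  · have e : ∀ w, (m, w) ∈ switch I M f n ↔ (m, w) ∈ M := by
      intro w
      rw [mem_switch]
      constructor
      · rintro (h | ⟨-, i, hi, h, -⟩)
        · exact h.1
        · exact (hx i hi.le h).elim
      · exact fun h => .inl ⟨h, fun ⟨i, hi, _, h'⟩ => hx (i + 1) hi h'⟩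
    have : ManPrefers I (switch I M f n) M m ↔ ManPrefers I M (switch I M f n) m := by
      simp only [ManPrefers, ManMatched, e]
    simp [vote, this]
  · have e : ∀ m, (m, w) ∈ switch I M f n ↔ (m, w) ∈ M := by
      intro m
      rw [mem_switch]
      constructor
      · rintro (h | ⟨-, i, hi, -, h⟩)
        · exact h.1
        · exact (hx (i + 1) hi h).elim
      · exact fun h => .inl ⟨h, fun ⟨i, hi, h', _⟩ => hx i hi.le h'⟩
    have : WomanPrefers I (switch I M f n) M w ↔ WomanPrefers I M (switch I M f n) w := by
      simp only [WomanPrefers, WomanMatched, e]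
    simp [vote, this]

end Switch

/-- In a popular feasible matching no tight chain leads from an unmatched man to a
non-critical man of higher level. -/
theorem IsPFM.level_le_of_reflTransGen [Fintype A] [Fintype B] (hM : I.IsPFM M)
    {lA : A → ℕ} {lB : B → ℕ} {a b : A} (ha : ¬ ManMatched M a) (hb : b ∉ I.C)
    (h : Relation.ReflTransGen (TightStep I M lA lB) (Sum.inl a) (Sum.inl b)) :
    lA b ≤ lA a := by
  obtain ⟨n, f, h0, hn, hf, hinj⟩ := exists_injective_steps_of_reflTransGen h
  have hN := isFeasible_switch hM.1 h0 hn ha hb (fun i hi => (hf i hi).1) hinj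
  have hpop := hM.2 _ hN
  have hsum : ∑ x, vote I (switch I M f n) M x =
      ∑ i ∈ Finset.range (n + 1), vote I (switch I M f n) M (f i) := by
    rw [← Finset.sum_image (s := Finset.range (n + 1)) (g := f)
      (f := vote I (switch I M f n) M)]
    · refine (Finset.sum_subset (Finset.subset_univ _) fun x _ hx => ?_).symm
      refine vote_switch_eq_zero fun i hi he => hx ?_
      exact Finset.mem_image.2 ⟨i, Finset.mem_range.2 (by omega), he⟩
    · intro i hi j hj he
      simp only [Finset.coe_range, Set.mem_Iio] at hi hj
      exact hinj i j (by omega) (by omega) he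
  have key : ∀ i ≤ n, 2 * (level lA lB (f i) - level lA lB (f 0)) ≤
      ∑ j ∈ Finset.range i, vote I (switch I M f n) M (f j) +
        Sum.elim (fun _ => 0) (fun _ => vote I (switch I M f n) M (f i)) (f i) := by
    intro i
    induction i with
    | zero => simp [h0]
    | succ i ih =>
      intro hi
      have ih := ih (by omega)
      obtain ⟨hd, ht⟩ := hf i hi
      rw [Finset.sum_range_succ]
      rcases hfi : f i with m | w
      · rw [hfi] at hd
        obtain ⟨w, hy, hE, hnM⟩ := hd.exists_of_inl
        have hmem : (m, w) ∈ switch I M f n := mem_switch.2 (.inr ⟨hE, i, hi, hfi, hy⟩)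
        have hv := two_mul_labelSum_le_vote hM.1.1 hN.1 hmem hnM
        simp only [hfi, hy, Sum.elim_inl, Sum.elim_inr] at ih ht ⊢
        linarith
      · rw [hfi] at hd
        obtain ⟨m, hy, hmM⟩ := hd.exists_of_inr
        have : labelSum I M (Sum.inr w) (Sum.inl m) = 0 := by
          simp [labelSum, StepPP, StepMM, PlusPlus, MinusMinus, hmM]
        simp only [hfi, hy, Sum.elim_inl, Sum.elim_inr] at ih ht ⊢
        linarith
  have hk := key n le_rfl
  rw [sum_vote, Finset.sum_range_succ] at hsum
  have hb' := neg_one_le_vote I (switch I M f n) M (f n)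
  rw [h0, hn] at hk
  rw [hn] at hsum hb'
  simp only [level, Sum.elim_inl] at hk
  omega

theorem IsSIAP.exists_oriented {ρ : AltPath I M} (h : IsSIAP I M ρ) :
    ∃ ρ' : AltPath I M, (∀ x, ρ.Mem x → ρ'.Mem x) ∧
      (∃ m, ρ'.vert 0 = Sum.inl m ∧ ¬ ManMatched M m) ∧
      (∃ w, ρ'.vert ρ'.len = Sum.inr w ∧ ¬ WomanMatched M w) ∧ ρ'.countPP = ρ'.countMM := by
  obtain ⟨⟨hm, hw⟩ | ⟨hw, hm⟩, hc⟩ := h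
  · exact ⟨ρ, fun _ => id, hm, hw, hc⟩
  · refine ⟨ρ.reverse, fun _ => .reverse, ?_, ?_, ?_⟩
    · simpa [AltPath.reverse] using hm
    · simpa [AltPath.reverse] using hw
    · rw [ρ.countPP_reverse, ρ.countMM_reverse, hc]

theorem IsSRAP.exists_oriented {lA : A → ℕ} {lB : B → ℕ} {ρ : AltPath I M}
    (h : IsSRAP I M lA lB ρ) :
    ∃ ρ' : AltPath I M, (∀ x, ρ.Mem x → ρ'.Mem x) ∧ StepM M (ρ'.vert 0) (ρ'.vert 1) ∧
      (∃ w, ρ'.vert 0 = Sum.inr w ∧ lB w = 0) ∧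
      (∃ m, ρ'.vert ρ'.len = Sum.inl m ∧ m ∉ I.C ∧ lA m = 1) ∧
      ρ'.countPP = ρ'.countMM + 1 := by
  obtain ⟨hs, he, ⟨⟨w, hw, -, hl⟩, hm⟩ | ⟨hm, ⟨w, hw, -, hl⟩⟩, hc⟩ := h
  · exact ⟨ρ, fun _ => id, hs, ⟨w, hw, hl⟩, hm, hc⟩
  · refine ⟨ρ.reverse, fun _ => .reverse, ?_, ⟨w, ?_, hl⟩, ?_, ?_⟩
    · rw [stepM_comm]
      simpa [AltPath.reverse] using he
    · simpa [AltPath.reverse] using hw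
    · simpa [AltPath.reverse] using hm
    · rw [ρ.countPP_reverse, ρ.countMM_reverse, hc]

end CritInstance

/-- Let `M` be a popular feasible matching and let `(lA, lB)` be a level
assignment such that matched partners share a level, unmatched vertices have level 0,
every `(+1,+1)` edge goes to a strictly higher level woman, every edge from a man at level
`i` to a woman at level `i − 1` is a `(−1,−1)` edge, and no edge goes from a man at level
`i` to a woman at level `≤ i − 2`. Then no vertex lies both on a size-increasing
alternating path for `M` and on a size-reducing alternating path for `M` w.r.t. the
levels. -/
theorem no_vertex_on_SIAP_and_SRAP {A : Type u} {B : Type v} [Fintype A] [Fintype B]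
    (I : CritInstance A B) (M : Finset (A × B)) (hM : I.IsPFM M)
    (lA : A → ℕ) (lB : B → ℕ)
    (h1 : ∀ m w, (m, w) ∈ M → lA m = lB w)
    (h2 : ∀ m, ¬ CritInstance.ManMatched M m → lA m = 0)
    (h3 : ∀ w, ¬ CritInstance.WomanMatched M w → lB w = 0)
    (h4 : ∀ m w, CritInstance.PlusPlus I M m w → lA m < lB w)
    (h5 : ∀ m w, (m, w) ∈ I.E → lB w + 1 = lA m → CritInstance.MinusMinus I M m w)
    (h6 : ∀ m w, (m, w) ∈ I.E → ¬ (lB w + 2 ≤ lA m)) :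
    ¬ ∃ (u : A ⊕ B) (ρ σ : CritInstance.AltPath I M),
        CritInstance.IsSIAP I M ρ ∧ CritInstance.IsSRAP I M lA lB σ ∧
        ρ.Mem u ∧ σ.Mem u := by
  rintro ⟨u, ρ, σ, hρ, hσ, hu, hu'⟩
  have hl : CritInstance.LevelConds I M lA lB := ⟨h1, h4, h5, h6⟩
  obtain ⟨ρ, hρm, ⟨a, ha, haM⟩, ⟨w, hw, hwM⟩, hc⟩ := hρ.exists_oriented
  obtain ⟨σ, hσm, hs, ⟨x, hx, hxl⟩, ⟨b, hb, hbC, hbl⟩, hc'⟩ := hσ.exists_oriented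
  have tρ := ρ.tightStep hl (by
    have := ρ.adj 0 ρ.len_pos
    rw [ha] at this ⊢
    rcases hy : ρ.vert (0 + 1) with m | y <;> rw [hy] at this
    · exact this.elim
    · exact ⟨this, fun hM' => haM ⟨y, hM'⟩⟩) (by
    simp [ha, hw, hc, CritInstance.level, h2 a haM, h3 w hwM])
  have tσ := σ.tightStep hl (by
    rw [hx] at hs ⊢
    rcases hy : σ.vert 1 with m | y <;> rw [hy] at hs <;> exact hs) (by
    simp [hx, hb, hc', CritInstance.level, hxl, hbl])
  obtain ⟨i, hi, rfl⟩ := hρm u hu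
  obtain ⟨j, hj, he⟩ := hσm _ hu'
  have r1 := CritInstance.reflTransGen_of_steps tρ (Nat.zero_le i) hi
  have r2 := CritInstance.reflTransGen_of_steps tσ hj le_rfl
  rw [ha] at r1
  rw [he, hb] at r2
  have := hM.level_le_of_reflTransGen haM hbC (r1.trans r2)
  rw [hbl, h2 a haM] at this
  omega
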